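/- arXiv:1201.5077 — 3 statements merged into one kernel-verified Lean document; each statement's English description precedes it below -/
import Mathlib

section
/- (Arithmetic content of Lemma 2.2, parts 1 and 3.) Let μ, c1, c2 be real numbers with μ ≥ 1 > c1 + c2 > c1 > c2 > 0, and let p, q, r1, r2 be integers. If 2(p−1)(q−1) − r1(r1−1) − r2(r2−1) ≥ 0 (the adjunction inequality for the class A = pB + qF − r1·E1 − r2·E2) and μ·p + q − c1·r1 − c2·r2 > 0 (positivity of the symplectic area of A), then p ≥ 0. Moreover, if in addition p = 1, then r1 ∈ {0,1} and r2 ∈ {0,1}. -/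
/-- Arithmetic content of Lemma 2.2, parts 1 and 3: for a class
`A = p·B + q·F − r1·E1 − r2·E2` satisfying the adjunction inequality and having
positive symplectic area (where `ω(B) = μ`, `ω(F) = 1`, `ω(E1) = c1`, `ω(E2) = c2`
and `μ ≥ 1 > c1 + c2 > c1 > c2 > 0`), one has `p ≥ 0`; and if moreover `p = 1`
then `r1, r2 ∈ {0, 1}`. -/
theorem statement0 (μ c1 c2 : ℝ) (p q r1 r2 : ℤ)
    (hμ : 1 ≤ μ) (h1 : c1 + c2 < 1) (h2 : c1 < c1 + c2) (h3 : c2 < c1) (h4 : 0 < c2)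
    (hadj : 0 ≤ 2 * (p - 1) * (q - 1) - r1 * (r1 - 1) - r2 * (r2 - 1))
    (harea : 0 < μ * (p : ℝ) + (q : ℝ) - c1 * (r1 : ℝ) - c2 * (r2 : ℝ)) :
    0 ≤ p ∧ (p = 1 → (r1 = 0 ∨ r1 = 1) ∧ (r2 = 0 ∨ r2 = 1)) := by
  have key : ∀ r : ℤ, 0 ≤ r * (r - 1) := by
    intro r
    rcases le_or_gt r 0 with h | h
    · nlinarith
    · have : 1 ≤ r := h
      nlinarith
  have k1 := key r1
  have k2 := key r2
  constructor
  · by_contra hp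
    have hp : p ≤ -1 := by omega
    have hq : q ≤ 1 := by
      by_contra hq
      have hq : 2 ≤ q := by omega
      nlinarith [mul_nonneg (show (0:ℤ) ≤ -1 - p by omega) (show (0:ℤ) ≤ q - 2 by omega)]
    -- the larger of `-r1`, `-r2` is at least `-p + 1 - q`
    have bound : ∀ r : ℤ, r ≤ p + q - 1 → 2 * (p - 1) * (q - 1) < r * (r - 1) := by
      intro r hr
      have a : (p + q - 1) * (p + q - 2) ≤ r * (r - 1) := by nlinarith
      nlinarith [key (1 - q), mul_nonneg (show (0:ℤ) ≤ -1 - p by omega) (show (0:ℤ) ≤ -p by omega)]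
    have b1 : p + q ≤ r1 := by
      by_contra h
      have := bound r1 (by omega)
      linarith
    have b2 : p + q ≤ r2 := by
      by_contra h
      have := bound r2 (by omega)
      linarith
    have b1' : (p : ℝ) + q ≤ r1 := by exact_mod_cast b1
    have b2' : (p : ℝ) + q ≤ r2 := by exact_mod_cast b2
    have hp' : (p : ℝ) ≤ -1 := by exact_mod_cast hp
    have hq' : (q : ℝ) ≤ 1 := by exact_mod_cast hq
    have e1 := mul_le_mul_of_nonneg_left b1' (show 0 ≤ c1 by linarith)
    have e2 := mul_le_mul_of_nonneg_left b2' h4.le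
    have e3 : μ * (p : ℝ) ≤ p := by nlinarith
    have e4 := mul_nonneg (show 0 ≤ 1 - c1 - c2 by linarith) (show (0:ℝ) ≤ -(p + q) by linarith)
    nlinarith
  · rintro rfl
    have z1 : r1 * (r1 - 1) = 0 := by linarith
    have z2 : r2 * (r2 - 1) = 0 := by linarith
    rcases mul_eq_zero.mp z1 with h | h <;> rcases mul_eq_zero.mp z2 with h' | h' <;> omega
end

section
/- (Arithmetic content of Lemma 2.2, part 2: classification in the fiber case p = 0.) Let c1, c2 be real numbers with 0 < c2 < c1 and c1 + c2 < 1, and let q, r1, r2 be integers. If 2(q−1) + r1(r1−1) + r2(r2−1) ≤ 0 and q − c1·r1 − c2·r2 > 0, then (q, r1, r2) is one of the seven triples (1,0,0), (1,1,0), (1,0,1), (1,1,1), (0,−1,0), (0,0,−1), (0,−1,1); equivalently, the class qF − r1·E1 − r2·E2 is one of F, F−E1, F−E2, F−E1−E2, E1, E2, E1−E2. -/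
/-- Arithmetic content of Lemma 2.2, part 2 (classification in the fiber case
`p = 0`): if the class `q·F − r1·E1 − r2·E2` satisfies the adjunction inequality
and has positive area (with `ω(F) = 1`, `ω(E1) = c1`, `ω(E2) = c2` and
`0 < c2 < c1`, `c1 + c2 < 1`), then `(q, r1, r2)` is one of the seven triples
corresponding to `F`, `F−E1`, `F−E2`, `F−E1−E2`, `E1`, `E2`, `E1−E2`. -/
theorem statement1 (c1 c2 : ℝ) (q r1 r2 : ℤ)
    (h1 : 0 < c2) (h2 : c2 < c1) (h3 : c1 + c2 < 1)
    (hadj : 2 * (q - 1) + r1 * (r1 - 1) + r2 * (r2 - 1) ≤ 0)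
    (harea : 0 < (q : ℝ) - c1 * (r1 : ℝ) - c2 * (r2 : ℝ)) :
    (q = 1 ∧ r1 = 0 ∧ r2 = 0) ∨ (q = 1 ∧ r1 = 1 ∧ r2 = 0) ∨
    (q = 1 ∧ r1 = 0 ∧ r2 = 1) ∨ (q = 1 ∧ r1 = 1 ∧ r2 = 1) ∨
    (q = 0 ∧ r1 = -1 ∧ r2 = 0) ∨ (q = 0 ∧ r1 = 0 ∧ r2 = -1) ∨
    (q = 0 ∧ r1 = -1 ∧ r2 = 1) := by
  have p1 : 0 ≤ r1 * (r1 - 1) := by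
    rcases le_or_gt r1 0 with h | h <;> nlinarith
  have p2 : 0 ≤ r2 * (r2 - 1) := by
    rcases le_or_gt r2 0 with h | h <;> nlinarith
  have hq1 : q ≤ 1 := by linarith
  have hq0 : 0 ≤ q := by
    by_contra! hq
    -- one of the two vertex conditions must hold
    have key : r1 < q ∨ r1 + r2 < 2 * q := by
      by_contra! hk
      obtain ⟨ha, hb⟩ := hk
      have ha' : (q : ℝ) ≤ r1 := by exact_mod_cast ha
      have hb' : 2 * (q : ℝ) ≤ r1 + r2 := by exact_mod_cast hb
      have hq' : (q : ℝ) < 0 := by exact_mod_cast hq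
      nlinarith [mul_nonneg (sub_nonneg.2 h2.le) (sub_nonneg.2 ha'),
        mul_nonneg h1.le (sub_nonneg.2 hb'),
        mul_pos (sub_pos.2 h3) (neg_pos.2 hq')]
    rcases key with h | h
    · nlinarith
    · nlinarith [sq_nonneg (r1 - r2)]
  have b1 : -1 ≤ r1 := by nlinarith
  have b2 : r1 ≤ 2 := by nlinarith
  have b3 : -1 ≤ r2 := by nlinarith
  have b4 : r2 ≤ 2 := by nlinarith
  interval_cases q <;> interval_cases r1 <;> interval_cases r2 <;>
    first
    | (exfalso; norm_num at hadj; done)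
    | (exfalso; push_cast at harea; linarith)
    | simp
end

section
/- (Inflation computation in Step 1 of the proof of Proposition 3.4, case λ ≤ c2, using negative inflation along E1−E2.) Let ℓ ≥ 1 be an integer and let λ, c1, c2 be real numbers with 0 < λ ≤ c2 < c1 and c1 + c2 < 1; set μ = ℓ + λ. For b ≥ 0 put e = (c1+c2)·b/(1−c1−c2), define the linear functional ω_{be} = (ω_{μ,c1,c2} + b·PD(D_{4ℓ+1}) + e·PD(D_{4ℓ−1}))/(1+b+e) on H, put a = c2·b/(1−c1−c2+b), and define ω_b = ω_{be} + a·PD(E1−E2). Then: (i) 2a < ω_{be}(E1−E2); (ii) ω_b(F) = 1, ω_b(E1) = c1, ω_b(E2) = c2; (iii) ω_b(B) = (μ(1−c1−c2) + b·ℓ)/(1−c1−c2+b); and (iv) for every ε with 0 < ε ≤ λ there exists b ≥ 0 with ω_b(B) = ℓ + ε. -/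
/-- `H = ℤ⁴` with basis `B, F, E1, E2`. -/
def Bv : Fin 4 → ℤ := ![1, 0, 0, 0]
def Fv : Fin 4 → ℤ := ![0, 1, 0, 0]
def E1v : Fin 4 → ℤ := ![0, 0, 1, 0]
def E2v : Fin 4 → ℤ := ![0, 0, 0, 1]

/-- The intersection form: `Q(B,F) = 1`, `Q(B,B) = Q(F,F) = 0`,
`Q(E1,E1) = Q(E2,E2) = −1`, all other pairings of basis vectors zero. -/
def Qform (v w : Fin 4 → ℤ) : ℤ := v 0 * w 1 + v 1 * w 0 - v 2 * w 2 - v 3 * w 3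

/-- `PD A : H → ℤ`, `C ↦ Q(A, C)`. -/
def PD (A v : Fin 4 → ℤ) : ℤ := Qform A v

/-- The classes `D i`: `D (4k+1) = B + kF`, `D (4k) = B + kF − E2`,
`D (4k−1) = B + kF − E1`, `D (4k−2) = B + kF − E1 − E2`. -/
def Dcl (i : ℤ) : Fin 4 → ℤ :=
  if i % 4 = 0 then ![1, i / 4, 0, -1]
  else if i % 4 = 1 then ![1, (i - 1) / 4, 0, 0]
  else if i % 4 = 2 then ![1, (i + 2) / 4, -1, -1]
  else ![1, (i + 1) / 4, -1, 0]

/-- The area functional `ω_{μ,c1,c2}` with values `μ, 1, c1, c2` on `B, F, E1, E2`. -/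
noncomputable def omegaF (μ c1 c2 : ℝ) (v : Fin 4 → ℤ) : ℝ :=
  μ * (v 0 : ℝ) + (v 1 : ℝ) + c1 * (v 2 : ℝ) + c2 * (v 3 : ℝ)

/-- `ω_{be} = (ω_{μ,c1,c2} + b·PD(D_{4ℓ+1}) + e·PD(D_{4ℓ−1}))/(1+b+e)` with
`e = (c1+c2)·b/(1−c1−c2)`. -/
noncomputable def wbe (l : ℤ) (μ c1 c2 b : ℝ) (v : Fin 4 → ℤ) : ℝ :=
  (omegaF μ c1 c2 v + b * (PD (Dcl (4 * l + 1)) v : ℝ) +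
      ((c1 + c2) * b / (1 - c1 - c2)) * (PD (Dcl (4 * l - 1)) v : ℝ)) /
    (1 + b + (c1 + c2) * b / (1 - c1 - c2))

/-- `ω_b = ω_{be} + a·PD(E1−E2)` with `a = c2·b/(1−c1−c2+b)`. -/
noncomputable def wb (l : ℤ) (μ c1 c2 b : ℝ) (v : Fin 4 → ℤ) : ℝ :=
  wbe l μ c1 c2 b v + (c2 * b / (1 - c1 - c2 + b)) * (PD (E1v - E2v) v : ℝ)

lemma Dcl_one (l : ℤ) : Dcl (4 * l + 1) = ![1, l, 0, 0] := by
  have a : (4 * l + 1) % 4 = 1 := by omega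
  have b : (4 * l + 1 - 1) / 4 = l := by omega
  simp only [Dcl, a, b]
  norm_num

lemma Dcl_three (l : ℤ) : Dcl (4 * l - 1) = ![1, l, -1, 0] := by
  have a : (4 * l - 1) % 4 = 3 := by omega
  have b : (4 * l - 1 + 1) / 4 = l := by omega
  simp only [Dcl, a, b]
  norm_num

lemma wbe_eq (l : ℤ) (μ c1 c2 b : ℝ) (hs : 0 < 1 - c1 - c2) (hb : 0 ≤ b) (v : Fin 4 → ℤ) :
    wbe l μ c1 c2 b v =
      ((1 - c1 - c2) * omegaF μ c1 c2 v + b * ((v 1 : ℝ) + l * v 0) + (c1 + c2) * b * v 2) /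
        (1 - c1 - c2 + b) := by
  have hd : 1 + b + (c1 + c2) * b / (1 - c1 - c2) = (1 - c1 - c2 + b) / (1 - c1 - c2) := by
    field_simp
    ring
  have hsb : 1 - c1 - c2 + b ≠ 0 := by positivity
  have hs' := hs.ne'
  unfold wbe
  rw [hd, Dcl_one, Dcl_three]
  simp only [PD, Qform]
  simp
  field_simp
  ring

/-- Inflation computation in Step 1 of the proof of Proposition 3.4 (case
`λ ≤ c2`, negative inflation along `E1−E2`): for all `b ≥ 0`,
(i) `2a < ω_{be}(E1−E2)`; (ii) `ω_b(F) = 1`, `ω_b(E1) = c1`, `ω_b(E2) = c2`;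
(iii) `ω_b(B) = (μ(1−c1−c2) + b·ℓ)/(1−c1−c2+b)`; and (iv) for every
`0 < ε ≤ λ` there is `b ≥ 0` with `ω_b(B) = ℓ + ε`. -/
theorem statement13 (l : ℤ) (hl : 1 ≤ l) (lam c1 c2 μ : ℝ)
    (h0 : 0 < lam) (h1 : lam ≤ c2) (h2 : c2 < c1) (h3 : c1 + c2 < 1)
    (hμ : μ = (l : ℝ) + lam) :
    (∀ b : ℝ, 0 ≤ b →
      2 * (c2 * b / (1 - c1 - c2 + b)) < wbe l μ c1 c2 b (E1v - E2v) ∧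
      wb l μ c1 c2 b Fv = 1 ∧ wb l μ c1 c2 b E1v = c1 ∧ wb l μ c1 c2 b E2v = c2 ∧
      wb l μ c1 c2 b Bv = (μ * (1 - c1 - c2) + b * (l : ℝ)) / (1 - c1 - c2 + b)) ∧
    (∀ ε : ℝ, 0 < ε → ε ≤ lam →
      ∃ b : ℝ, 0 ≤ b ∧ wb l μ c1 c2 b Bv = (l : ℝ) + ε) := by
  have hs : 0 < 1 - c1 - c2 := by linarith
  have hB : ∀ b : ℝ, 0 ≤ b →
      wb l μ c1 c2 b Bv = (μ * (1 - c1 - c2) + b * (l : ℝ)) / (1 - c1 - c2 + b) := by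
    intro b hb
    have hsb : 1 - c1 - c2 + b ≠ 0 := by positivity
    rw [wb, wbe_eq l μ c1 c2 b hs hb]
    simp [omegaF, PD, Qform, Bv, E1v, E2v]
    ring
  refine ⟨fun b hb => ?_, fun ε hε hle => ?_⟩
  · have hsb : 0 < 1 - c1 - c2 + b := by positivity
    have hsb' := hsb.ne'
    refine ⟨?_, ?_, ?_, ?_, hB b hb⟩
    · rw [wbe_eq l μ c1 c2 b hs hb, ← mul_div_assoc]
      apply div_lt_div_of_pos_right _ hsb
      simp [omegaF, E1v, E2v]
      nlinarith [mul_pos hs (sub_pos.2 h2), mul_nonneg hb (sub_pos.2 h2).le]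
    all_goals
      rw [wb, wbe_eq l μ c1 c2 b hs hb]
      simp [omegaF, PD, Qform, Fv, E1v, E2v, hsb']
      try (field_simp <;> ring)
  · have hb : 0 ≤ (1 - c1 - c2) * (lam - ε) / ε :=
      div_nonneg (mul_nonneg hs.le (by linarith)) hε.le
    refine ⟨_, hb, ?_⟩
    rw [hB _ hb, hμ, div_eq_iff (by positivity)]
    field_simp
    ring
end
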